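/- Let G be a finite group and n ≥ 1. Assume that |G| does not divide n and that G does not act nontrivially on any algebraic curve of genus at most (n−1)². Then no faithful irreducible G-curve C over the perfect field k admits a rational function of degree n (i.e., no dominant map C → P^1 of degree n exists). -/

import Mathlib

open IntermediateField Multiplicative

/-- `K` is (the function field of) an irreducible variety over `k`:
a finitely generated field extension of `k`. -/
def IsFunctionField (k K : Type) [Field k] [Field K] [Algebra k K] : Prop :=
  ∃ s : Finset K, IntermediateField.adjoin k (s : Set K) = ⊤

/-- The variety with function field `K` has dimension at most `d`, i.e. the
transcendence degree of `K/k` is at most `d`. -/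
def DimLE (k K : Type) [Field k] [Field K] [Algebra k K] (d : ℕ) : Prop :=
  ∃ s : Finset K, s.card ≤ d ∧ Algebra.IsAlgebraic (IntermediateField.adjoin k (s : Set K)) K

/-- `K` is the function field of an irreducible algebraic curve over `k`: a finitely
generated field extension of `k` of transcendence degree one. -/
def IsCurveField (k K : Type) [Field k] [Field K] [Algebra k K] : Prop :=
  IsFunctionField k K ∧ DimLE k K 1 ∧ ∃ x : K, Transcendental k x

/-- The rational function `f` on the curve with function field `K` has degree `n`,
i.e. the corresponding dominant rational map to `P¹` is generically `n`-to-1: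
`[K : k(f)] = n` (in particular this extension is finite). -/
def RatFnDegree (k K : Type) [Field k] [Field K] [Algebra k K] (f : K) (n : ℕ) : Prop :=
  FiniteDimensional (IntermediateField.adjoin k ({f} : Set K)) K ∧
    Module.finrank (IntermediateField.adjoin k ({f} : Set K)) K = n

section Genus

variable (k F : Type) [Field k] [Field F] [Algebra k F]

/-- A place of the (smooth projective model of the) curve with function field `F`
over `k`: a normalized discrete valuation of `F` that is trivial on `k`. -/
structure PlaceOf where
  v : Valuation F (WithZero (Multiplicative ℤ))
  surjective : Function.Surjective v
  trivialOnBase : ∀ c : k, c ≠ 0 → v (algebraMap k F c) = 1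

variable {k F}

/-- The degree `[κ(P) : k]` of the residue field of a place over `k`. -/
noncomputable def PlaceOf.degree (P : PlaceOf k F) : ℕ :=
  letI : Algebra k (IsLocalRing.ResidueField P.v.valuationSubring) :=
    ((IsLocalRing.residue (R := ↥P.v.valuationSubring)).comp
      ((algebraMap k F).codRestrict P.v.valuationSubring.toSubring (fun c => by
        rcases eq_or_ne c 0 with h | h
        · simp [h, Valuation.mem_valuationSubring_iff]
        · exact le_of_eq (P.trivialOnBase c h)))).toAlgebra
  Module.finrank k (IsLocalRing.ResidueField P.v.valuationSubring)

variable (k F)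

/-- The degree of a divisor (an element of the free abelian group on the places)
on the curve with function field `F`. -/
noncomputable def DivisorOf.deg (D : PlaceOf k F →₀ ℤ) : ℤ :=
  D.sum fun P n => n * (P.degree : ℤ)

/-- The Riemann–Roch space `L(D) = {f ∈ F : div(f) + D ≥ 0}` of a divisor `D`,
as a `k`-subspace of `F`. -/
noncomputable def RRSpace (D : PlaceOf k F →₀ ℤ) : Submodule k F where
  carrier := {f | ∀ P : PlaceOf k F, P.v f ≤ ((ofAdd (D P) : Multiplicative ℤ) :
    WithZero (Multiplicative ℤ))}
  add_mem' := fun hf hg P => le_trans (Valuation.map_add _ _ _) (max_le (hf P) (hg P))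
  zero_mem' := fun P => by simp
  smul_mem' := fun c f hf P => by
    rw [Algebra.smul_def, Valuation.map_mul]
    rcases eq_or_ne c 0 with h | h
    · simp [h]
    · rw [P.trivialOnBase c h, one_mul]
      exact hf P

/-- `ℓ(D) = dim_k L(D)`. -/
noncomputable def ell (D : PlaceOf k F →₀ ℤ) : ℕ :=
  Module.finrank k (RRSpace k F D)

/-- The genus of the (smooth projective model of the) curve with function field
`F` over `k`: the maximal value of `deg D + ℓ(0) - ℓ(D)` over all divisors `D`
(for `D = 0` this value is `0`, and by the Riemann–Roch theorem the maximum is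
attained, and equals the genus, once `deg D` is large enough). -/
noncomputable def genus : ℕ :=
  sSup {g : ℕ | ∃ D : PlaceOf k F →₀ ℤ,
    (g : ℤ) + ell k F D = DivisorOf.deg k F D + ell k F 0}

end Genus

open WithZero

namespace PlaceOf

variable {k F : Type} [Field k] [Field F] [Algebra k F] (P : PlaceOf k F)

/-- The `k`-algebra structure on the residue field of a place. -/
noncomputable instance residueAlgebra :
    Algebra k (IsLocalRing.ResidueField P.v.valuationSubring) :=
  ((IsLocalRing.residue (R := ↥P.v.valuationSubring)).comp
      ((algebraMap k F).codRestrict P.v.valuationSubring.toSubring (fun c => by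
        rcases eq_or_ne c 0 with h | h
        · simp [h]
        · exact le_of_eq (P.trivialOnBase c h)))).toAlgebra

/-- The residue field of a place. -/
abbrev ResField : Type := IsLocalRing.ResidueField P.v.valuationSubring

theorem degree_eq : P.degree = Module.finrank k P.ResField := rfl

theorem v_algebraMap_le (c : k) : P.v (algebraMap k F c) ≤ 1 := by
  rcases eq_or_ne c 0 with h | h
  · simp [h]
  · exact (P.trivialOnBase c h).le

variable {P} in
theorem ne_zero_of_v_eq_exp {f : F} {m : ℤ} (h : P.v f = exp m) : f ≠ 0 := by
  rintro rfl
  rw [map_zero] at h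
  exact exp_ne_zero h.symm

theorem v_one_add_of_one_lt {y : F} (h : 1 < P.v y) : P.v (1 + y) = P.v y :=
  Valuation.map_add_eq_of_lt_right P.v (by rwa [map_one])

theorem v_one_add_of_lt_one {y : F} (h : P.v y < 1) : P.v (1 + y) = 1 := by
  rw [Valuation.map_add_eq_of_lt_left P.v (by rwa [map_one]), map_one]

theorem lt_exp_iff {x : ℤᵐ⁰} {m : ℤ} : x < exp m ↔ x ≤ exp (m - 1) := by
  rcases eq_or_ne x 0 with rfl | hx
  · simp
  · rw [← log_lt_iff_lt_exp hx, ← log_le_iff_le_exp hx]; omega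

end PlaceOf

section LocalRR

variable {k F : Type} [Field k] [Field F] [Algebra k F]

/-- The functions whose poles at the places in `S` are bounded by `D`. -/
def localRR (S : Set (PlaceOf k F)) (D : PlaceOf k F → ℤ) : Submodule k F where
  carrier := {f | ∀ P ∈ S, P.v f ≤ exp (D P)}
  add_mem' := fun hf hg P hP => (P.v.map_add _ _).trans (max_le (hf P hP) (hg P hP))
  zero_mem' := fun P _ => by simp
  smul_mem' := fun c f hf P hP => by
    rw [Algebra.smul_def, Valuation.map_mul]
    exact (mul_le_of_le_one_left' (P.v_algebraMap_le c)).trans (hf P hP)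

theorem localRR_mono {S : Set (PlaceOf k F)} {D E : PlaceOf k F → ℤ} (h : ∀ P, D P ≤ E P) :
    localRR S D ≤ localRR S E := fun _ hf P hP => (hf P hP).trans (exp_le_exp.2 (h P))

theorem mul_mem_localRR {S : Set (PlaceOf k F)} {D E : PlaceOf k F → ℤ} {f g : F}
    (hf : f ∈ localRR S D) (hg : g ∈ localRR S E) : f * g ∈ localRR S (D + E) := by
  intro P hP
  rw [map_mul, Pi.add_apply, exp_add]
  exact mul_le_mul' (hf P hP) (hg P hP)

theorem algebraMap_mem_localRR (S : Set (PlaceOf k F)) (c : k) :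
    algebraMap k F c ∈ localRR S 0 := fun P _ => by
  simpa using P.v_algebraMap_le c

theorem RRSpace_eq_localRR (D : PlaceOf k F →₀ ℤ) : RRSpace k F D = localRR Set.univ D := by
  ext f
  exact ⟨fun h P _ => h P, fun h P => h P trivial⟩

/-- Taking the leading coefficient at a place. -/
theorem PlaceOf.exists_leadingCoeff (P : PlaceOf k F) (m : ℤ) :
    ∃ φ : localRR {P} (fun _ => m) →ₗ[k] P.ResField,
      Function.Surjective φ ∧ ∀ f, φ f = 0 ↔ P.v f ≤ exp (m - 1) := by
  obtain ⟨s, hs⟩ := P.surjective (exp (-m))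
  have hs0 : s ≠ 0 := PlaceOf.ne_zero_of_v_eq_exp hs
  have hmem : ∀ f : F, P.v (s * f) ≤ 1 ↔ P.v f ≤ exp m := by
    intro f
    rw [map_mul, hs, exp_neg, inv_mul_le_iff₀ exp_pos, mul_one]
  refine ⟨{ toFun := fun f => IsLocalRing.residue P.v.valuationSubring
              ⟨s * f, (hmem f).2 (f.2 P rfl)⟩
            map_add' := fun f g => ?_
            map_smul' := fun c f => ?_ }, ?_, ?_⟩
  · rw [← map_add]
    congr 1
    exact Subtype.ext (mul_add _ _ _)
  · rw [RingHom.id_apply, Algebra.smul_def]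
    refine Eq.trans ?_ (map_mul (IsLocalRing.residue P.v.valuationSubring) _ _)
    congr 1
    refine Subtype.ext ?_
    change s * (c • (f : F)) = algebraMap k F c * (s * f)
    rw [Algebra.smul_def]
    ring
  · intro y
    obtain ⟨⟨a, ha⟩, rfl⟩ := IsLocalRing.residue_surjective y
    refine ⟨⟨s⁻¹ * a, ?_⟩, ?_⟩
    · rintro Q rfl
      rw [← hmem, mul_inv_cancel_left₀ hs0]
      exact ha
    · change IsLocalRing.residue P.v.valuationSubring ⟨s * (s⁻¹ * a), _⟩ = _
      congr 1
      exact Subtype.ext (mul_inv_cancel_left₀ hs0 _)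
  · intro f
    change IsLocalRing.residue P.v.valuationSubring ⟨s * f, _⟩ = 0 ↔ _
    rw [IsLocalRing.residue_eq_zero_iff, Valuation.mem_maximalIdeal_iff, ← PlaceOf.lt_exp_iff]
    change P.v (s * f) < 1 ↔ _
    rw [map_mul, hs, exp_neg, inv_mul_lt_iff₀ exp_pos, mul_one]

end LocalRR

section Approximation

variable {k F : Type} [Field k] [Field F] [Algebra k F]

theorem PlaceOf.ext_v {P Q : PlaceOf k F} (h : P.v = Q.v) : P = Q := by
  cases P; cases Q; cases h; rfl

theorem PlaceOf.eq_of_le {P Q : PlaceOf k F} (h : ∀ f, P.v f ≤ 1 → Q.v f ≤ 1) : P = Q := by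
  refine PlaceOf.ext_v ?_
  obtain ⟨t, ht⟩ := P.surjective (exp (-1))
  have ht0 : t ≠ 0 := PlaceOf.ne_zero_of_v_eq_exp ht
  have hunit : ∀ f, P.v f = 1 → Q.v f = 1 := by
    intro f hf
    refine le_antisymm (h f hf.le) ?_
    have := h f⁻¹ (by simp [hf])
    rw [map_inv₀] at this
    refine (inv_le_one₀ ?_).1 this
    refine zero_lt_iff.2 (fun h0 => ?_)
    rw [map_eq_zero] at h0
    simp [h0] at hf
  have key : ∀ f : F, f ≠ 0 → Q.v f = Q.v t ^ (-log (P.v f)) := by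
    intro f hf
    have h1 : P.v (f * t ^ (log (P.v f))) = 1 := by
      rw [map_mul, map_zpow₀, ht, ← exp_zsmul]
      nth_rw 1 [← exp_log ((map_ne_zero P.v).2 hf)]
      rw [← exp_add]
      simp
    have h2 := hunit _ h1
    rw [map_mul, map_zpow₀] at h2
    rw [zpow_neg]
    exact eq_inv_of_mul_eq_one_left h2
  have hQt0 : Q.v t ≠ 0 := (map_ne_zero Q.v).2 ht0
  have hQt : Q.v t = exp (-1) := by
    obtain ⟨s, hs⟩ := Q.surjective (exp 1)
    have hs0 : s ≠ 0 := PlaceOf.ne_zero_of_v_eq_exp hs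
    have h3 := key s hs0
    rw [hs, ← exp_log hQt0, ← exp_zsmul, exp_inj, smul_eq_mul] at h3
    have h4 : log (Q.v t) ≤ 0 := by
      rw [log_le_iff_le_exp hQt0]
      exact h t (by rw [ht]; exact exp_le_exp.2 (by norm_num))
    rw [← exp_log hQt0, exp_inj]
    rcases Int.isUnit_iff.1 (IsUnit.of_mul_eq_one_right _ h3.symm) with h5 | h5 <;> omega
  ext f
  rcases eq_or_ne f 0 with rfl | hf
  · simp
  · rw [key f hf, hQt, ← exp_zsmul]
    nth_rw 1 [← exp_log ((map_ne_zero P.v).2 hf)]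
    simp

theorem exists_pow_mul_lt_one {x : ℤᵐ⁰} (hx : x < 1) (y : ℤᵐ⁰) :
    ∃ N : ℕ, ∀ m ≥ N, x ^ m * y < 1 := by
  rcases eq_or_ne x 0 with rfl | hx0
  · exact ⟨1, fun m hm => by rw [zero_pow (by omega)]; simp⟩
  rcases eq_or_ne y 0 with rfl | hy0
  · exact ⟨0, fun m _ => by simp⟩
  refine ⟨(log y).toNat + 1, fun m hm => ?_⟩
  have h1 : log x ≤ -1 := by
    have : log x < 0 := (log_lt_iff_lt_exp hx0).2 hx
    omega
  rw [← exp_log hx0, ← exp_log hy0, ← exp_nsmul, ← exp_add, ← exp_zero, exp_lt_exp, nsmul_eq_mul]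
  have : (m : ℤ) * log x ≤ m * (-1) := mul_le_mul_of_nonneg_left h1 (by positivity)
  omega

theorem PlaceOf.exists_one_lt_forall_lt_one (P : PlaceOf k F) (S : Finset (PlaceOf k F))
    (hP : P ∉ S) : ∃ y : F, 1 < P.v y ∧ ∀ Q ∈ S, Q.v y < 1 := by
  classical
  induction S using Finset.induction_on with
  | empty =>
    obtain ⟨s, hs⟩ := P.surjective (exp 1)
    exact ⟨s, by rw [hs, ← exp_zero, exp_lt_exp]; norm_num, by simp⟩
  | insert R S hR ih =>
    rw [Finset.mem_insert, not_or] at hP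
    obtain ⟨y, hy, hyS⟩ := ih hP.2
    obtain ⟨z, hz, hzR⟩ : ∃ z : F, 1 < P.v z ∧ R.v z < 1 := by
      have h1 : ∃ a, P.v a ≤ 1 ∧ 1 < R.v a := by
        by_contra! h
        exact hP.1 (PlaceOf.eq_of_le h)
      have h2 : ∃ b, R.v b ≤ 1 ∧ 1 < P.v b := by
        by_contra! h
        exact hP.1 (PlaceOf.eq_of_le h).symm
      obtain ⟨a, ha, ha'⟩ := h1
      obtain ⟨b, hb, hb'⟩ := h2
      have ha0 : a ≠ 0 := by
        rintro rfl
        simp at ha'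
      refine ⟨b / a, ?_, ?_⟩
      · rw [map_div₀, one_lt_div₀ (zero_lt_iff.2 ((map_ne_zero _).2 ha0))]
        exact ha.trans_lt hb'
      · rw [map_div₀, div_lt_one₀ (zero_lt_iff.2 ((map_ne_zero _).2 ha0))]
        exact hb.trans_lt ha'
    have hN : ∃ N : ℕ, 1 ≤ N ∧ ∀ Q ∈ S, Q.v y ^ N * Q.v z < 1 := by
      choose! M hM using fun Q (hQ : Q ∈ S) => exists_pow_mul_lt_one (hyS Q hQ) (Q.v z)
      refine ⟨S.sup M + 1, by omega, fun Q hQ => hM Q hQ _ ?_⟩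
      exact (Finset.le_sup hQ).trans (Nat.le_succ _)
    obtain ⟨N, hN1, hN⟩ := hN
    rcases le_or_gt (R.v y) 1 with hyR | hyR
    · refine ⟨y ^ N * z, ?_, ?_⟩
      · rw [map_mul, map_pow]
        exact hz.trans_le (le_mul_of_one_le_left' (one_le_pow₀ hy.le))
      · intro Q hQ
        rw [map_mul, map_pow]
        rcases Finset.mem_insert.1 hQ with rfl | hQ
        · exact (mul_le_of_le_one_left' (pow_le_one' hyR N)).trans_lt hzR
        · exact hN Q hQ
    · have hbig : ∀ Q : PlaceOf k F, 1 < Q.v y → Q.v (y ^ N / (1 + y ^ N)) = 1 := by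
        intro Q hQ
        have h1 : 1 < Q.v (y ^ N) := by
          rw [map_pow]
          exact one_lt_pow₀ hQ (by omega)
        have h2 : Q.v (1 + y ^ N) = Q.v (y ^ N) :=
          Q.v_one_add_of_one_lt h1
        rw [map_div₀, h2, div_self]
        exact (zero_lt_one.trans h1).ne'
      refine ⟨y ^ N / (1 + y ^ N) * z, ?_, ?_⟩
      · rwa [map_mul, hbig P hy, one_mul]
      · intro Q hQ
        rw [map_mul]
        rcases Finset.mem_insert.1 hQ with rfl | hQ
        · rwa [hbig Q hyR, one_mul]
        · have h1 : Q.v (y ^ N) < 1 := by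
            rw [map_pow]
            exact pow_lt_one₀ zero_le (hyS Q hQ) (by omega)
          have h2 : Q.v (1 + y ^ N) = 1 := Q.v_one_add_of_lt_one h1
          rw [map_div₀, h2, div_one, map_pow]
          exact hN Q hQ

theorem PlaceOf.exists_approx (P : PlaceOf k F) (S : Finset (PlaceOf k F)) (g : F) (hg : g ≠ 0)
    (hP : P ∉ S) (A : PlaceOf k F → ℤ) :
    ∃ f : F, P.v (f - g) < P.v g ∧ ∀ Q ∈ S, Q.v f ≤ exp (A Q) := by
  obtain ⟨y, hy, hyS⟩ := P.exists_one_lt_forall_lt_one S hP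
  choose! M hM using fun Q (hQ : Q ∈ S) => exists_pow_mul_lt_one (hyS Q hQ) (Q.v g * exp (-A Q))
  set N := S.sup M + 1
  refine ⟨y ^ N / (1 + y ^ N) * g, ?_, fun Q hQ => ?_⟩
  · have h1 : 1 < P.v (y ^ N) := by
      rw [map_pow]
      exact one_lt_pow₀ hy (by omega)
    have h2 : P.v (1 + y ^ N) = P.v (y ^ N) :=
      P.v_one_add_of_one_lt h1
    have h3 : 1 + y ^ N ≠ 0 := by
      intro h
      rw [h, map_zero] at h2
      exact (zero_lt_one.trans h1).ne h2
    have h4 : y ^ N / (1 + y ^ N) * g - g = -(g / (1 + y ^ N)) := by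
      field_simp
      ring
    rw [h4, Valuation.map_neg, map_div₀, h2]
    rw [div_lt_iff₀ (zero_lt_one.trans h1)]
    exact lt_mul_of_one_lt_right (zero_lt_iff.2 ((map_ne_zero _).2 hg)) h1
  · have h1 : Q.v (y ^ N) < 1 := by
      rw [map_pow]
      exact pow_lt_one₀ zero_le (hyS Q hQ) (by omega)
    have h2 : Q.v (1 + y ^ N) = 1 := Q.v_one_add_of_lt_one h1
    have h3 := hM Q hQ N ((Finset.le_sup hQ).trans (Nat.le_succ _))
    rw [map_mul, map_div₀, h2, div_one, map_pow]
    rw [exp_neg, ← mul_assoc, mul_inv_lt_iff₀ exp_pos, one_mul] at h3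
    exact h3.le

end Approximation

section FundamentalInequality

open Polynomial
open scoped IntermediateField.algebraAdjoinAdjoin

variable {k F : Type} [Field k] [Field F] [Algebra k F]

theorem aeval_mul_mem {h : F} {R : Submodule k F} (hR : ∀ r ∈ R, h * r ∈ R) (p : k[X]) {r : F}
    (hr : r ∈ R) : aeval h p * r ∈ R := by
  induction p using Polynomial.induction_on' with
  | add p q hp hq =>
    rw [map_add, add_mul]
    exact R.add_mem hp hq
  | monomial n a =>
    rw [aeval_monomial, mul_assoc, ← Algebra.smul_def]
    refine R.smul_mem _ ?_
    induction n with
    | zero => simpa using hr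
    | succ n ih =>
      rw [pow_succ', mul_assoc]
      exact hR _ ih

/-- Functions that are linearly independent over `k` modulo `h` are linearly independent
over `k(h)`. -/
theorem linearIndependent_of_mod {ι : Type*} [Fintype ι] {h : F} (h0 : h ≠ 0)
    {R I : Submodule k F} (hR : ∀ r ∈ R, h * r ∈ R) (hI : ∀ r ∈ R, h * r ∈ I) {u : ι → F}
    (hu : ∀ i, u i ∈ R) (H : ∀ c : ι → k, ∑ i, c i • u i ∈ I → c = 0) :
    LinearIndependent k⟮h⟯ u := by
  have key : ∀ (N : ℕ) (a : ι → k[X]), ∑ i, aeval h (a i) * u i = 0 → ∀ i, X ^ N ∣ a i := by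
    intro N
    induction N with
    | zero => simp
    | succ N ih =>
      intro a ha
      have hsplit : ∀ i, aeval h (a i) * u i =
          h * (aeval h (divX (a i)) * u i) + (a i).coeff 0 • u i := by
        intro i
        conv_lhs => rw [← divX_mul_X_add (a i)]
        rw [map_add, map_mul, aeval_X, aeval_C, Algebra.smul_def]
        ring
      have hc : (fun i => (a i).coeff 0) = 0 := by
        refine H _ ?_
        have h1 : ∑ i, (a i).coeff 0 • u i = -(h * ∑ i, aeval h (divX (a i)) * u i) := by
          rw [eq_neg_iff_add_eq_zero, Finset.mul_sum, ← Finset.sum_add_distrib, ← ha]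
          exact Finset.sum_congr rfl fun i _ => by rw [hsplit i, add_comm]
        rw [h1]
        exact I.neg_mem (hI _ (R.sum_mem fun i _ => aeval_mul_mem hR _ (hu i)))
      have hc' : ∀ i, (a i).coeff 0 = 0 := fun i => congrFun hc i
      have h2 : ∑ i, aeval h (divX (a i)) * u i = 0 := by
        simp only [hsplit, hc', zero_smul, add_zero] at ha
        rw [← Finset.mul_sum] at ha
        exact (mul_eq_zero.1 ha).resolve_left h0
      intro i
      have h3 := divX_mul_X_add (a i)
      rw [hc' i, C_0, add_zero] at h3
      rw [← h3, pow_succ]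
      exact mul_dvd_mul_right (ih _ h2 i) _
  rw [← LinearIndependent.iff_fractionRing (Algebra.adjoin k {h}) k⟮h⟯,
    Fintype.linearIndependent_iff]
  intro g hg i
  have hga : ∀ i, ∃ a : k[X], aeval h a = (g i : F) := by
    intro i
    exact (SetLike.ext_iff.1 (Algebra.adjoin_singleton_eq_range_aeval k h) (g i : F)).1 (g i).2
  choose a ha using hga
  have h1 : a i = 0 := by
    have h2 := key ((a i).natDegree + 1) a (by simp only [ha]; exact hg) i
    by_contra h3
    have h4 := natDegree_le_of_dvd h2 h3
    rw [natDegree_X_pow] at h4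
    omega
  refine Subtype.ext ?_
  rw [← ha, h1, map_zero]
  rfl

variable (k F) in
theorem card_le_finrank_of_mod {ι : Type*} [Fintype ι] {h : F} (h0 : h ≠ 0)
    [FiniteDimensional k⟮h⟯ F] {S : Set (PlaceOf k F)} {A : PlaceOf k F → ℤ}
    (hA : ∀ P ∈ S, P.v h ≤ exp (A P)) (hA0 : ∀ P ∈ S, A P ≤ 0) {u : ι → F}
    (hu : ∀ i, u i ∈ localRR S 0) (H : ∀ c : ι → k, ∑ i, c i • u i ∈ localRR S A → c = 0) :
    Fintype.card ι ≤ Module.finrank k⟮h⟯ F := by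
  have hhA : h ∈ localRR S A := hA
  have hh0 : h ∈ localRR S (0 : PlaceOf k F → ℤ) :=
    fun P hP => (hA P hP).trans (exp_le_exp.2 (hA0 P hP))
  refine (linearIndependent_of_mod h0 (R := localRR S 0) (I := localRR S A) ?_ ?_ hu
    H).fintype_card_le_finrank
  · intro r hr
    simpa using mul_mem_localRR hh0 hr
  · intro r hr
    simpa using mul_mem_localRR hhA hr

theorem PlaceOf.finite_resField (P : PlaceOf k F) {h : F} (h0 : h ≠ 0) (hP : P.v h < 1)
    [FiniteDimensional k⟮h⟯ F] : Module.Finite k P.ResField := by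
  rw [← Module.rank_lt_aleph0_iff]
  refine (rank_le (n := Module.finrank k⟮h⟯ F) fun s hs => ?_).trans_lt Cardinal.natCast_lt_aleph0
  obtain ⟨φ, hφ, hφ0⟩ := P.exists_leadingCoeff 0
  choose w hw using hφ
  rw [← Fintype.card_coe]
  refine card_le_finrank_of_mod k F h0 (S := {P}) (A := fun _ => -1) ?_ (by simp)
    (u := fun i : s => (w i : F)) (fun i => (w i).2) ?_
  · rintro Q rfl
    exact PlaceOf.lt_exp_iff.1 hP
  · intro c hc
    have h1 : φ (∑ i, c i • w i) = 0 := by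
      rw [hφ0]
      simpa using hc P rfl
    rw [map_sum] at h1
    simp only [map_smul, hw] at h1
    exact funext (Fintype.linearIndependent_iff.1 hs c h1)

open Classical in
theorem exists_independent_mod (S : Finset (PlaceOf k F))
    (hfin : ∀ P ∈ S, Module.Finite k P.ResField) (A : Multiset (PlaceOf k F))
    (hA : ∀ P ∈ A, P ∈ S) :
    ∃ u : Fin (A.map PlaceOf.degree).sum → F, (∀ i, u i ∈ localRR (S : Set (PlaceOf k F)) 0) ∧
      ∀ c : Fin (A.map PlaceOf.degree).sum → k,
        ∑ i, c i • u i ∈ localRR (S : Set (PlaceOf k F)) (fun P => -(A.count P : ℤ)) → c = 0 := by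
  induction A using Multiset.induction_on with
  | empty => exact ⟨fun _ => 0, fun i => Submodule.zero_mem _, fun c _ => funext fun i => by
      simpa using i.2⟩
  | cons P A ih =>
    obtain ⟨u, hu, H⟩ := ih fun Q hQ => hA Q (Multiset.mem_cons_of_mem hQ)
    have hPS : P ∈ S := hA P (Multiset.mem_cons_self _ _)
    have := hfin P hPS
    obtain ⟨φ, hφ, hφ0⟩ := P.exists_leadingCoeff (-(A.count P : ℤ))
    let b := Module.finBasis k P.ResField
    have hw : ∀ i, ∃ w : localRR {P} (fun _ => -(A.count P : ℤ)), φ w = b i ∧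
        ∀ Q ∈ S.erase P, Q.v (w : F) ≤ exp (-(A.count Q : ℤ)) := by
      intro i
      obtain ⟨g, hg⟩ := hφ (b i)
      have hg0 : (g : F) ≠ 0 := by
        intro h
        have h1 : g = 0 := Subtype.ext h
        rw [h1, map_zero] at hg
        exact b.ne_zero i hg.symm
      obtain ⟨f, hf, hfS⟩ := P.exists_approx (S.erase P) g hg0 (Finset.notMem_erase _ _)
        (fun Q => -(A.count Q : ℤ))
      have hgP : P.v (g : F) ≤ exp (-(A.count P : ℤ)) := g.2 P rfl
      have hfg : P.v (f - g) < exp (-(A.count P : ℤ)) := hf.trans_le hgP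
      have hfg' : f - g ∈ localRR {P} (fun _ => -(A.count P : ℤ)) := by
        rintro Q rfl
        exact hfg.le
      refine ⟨⟨f - g, hfg'⟩ + g, ?_, ?_⟩
      · rw [map_add, (hφ0 _).2 (PlaceOf.lt_exp_iff.1 hfg), zero_add, hg]
      · intro Q hQ
        simpa using hfS Q hQ
    choose w hwφ hwS using hw
    have hwmem : ∀ i, (w i : F) ∈
        localRR (S : Set (PlaceOf k F)) (fun P => -(A.count P : ℤ)) := by
      intro i Q hQ
      rcases eq_or_ne Q P with rfl | hQP
      · exact (w i).2 Q rfl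
      · exact hwS i Q (Finset.mem_erase.2 ⟨hQP, hQ⟩)
    suffices h : ∃ u : Fin (A.map PlaceOf.degree).sum ⊕ Fin (Module.finrank k P.ResField) → F,
        (∀ i, u i ∈ localRR (S : Set (PlaceOf k F)) 0) ∧ ∀ c : _ → k, ∑ i, c i • u i ∈
          localRR (S : Set (PlaceOf k F)) (fun Q => -((P ::ₘ A).count Q : ℤ)) → c = 0 by
      obtain ⟨u, hu, H⟩ := h
      have hcard : Fintype.card
          (Fin (A.map PlaceOf.degree).sum ⊕ Fin (Module.finrank k P.ResField)) =
          ((P ::ₘ A).map PlaceOf.degree).sum := by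
        rw [Fintype.card_sum, Fintype.card_fin, Fintype.card_fin, Multiset.map_cons,
          Multiset.sum_cons, PlaceOf.degree_eq, add_comm]
      let e := Fintype.equivFinOfCardEq hcard
      refine ⟨u ∘ e.symm, fun i => hu _, fun c hc => ?_⟩
      have h1 : c ∘ e = 0 := by
        refine H _ ?_
        rw [← e.sum_comp] at hc
        simpa using hc
      funext i
      simpa using congrFun h1 (e.symm i)
    refine ⟨Sum.elim u fun i => (w i : F), ?_, ?_⟩
    · rintro (i | i)
      · exact hu i
      · exact localRR_mono (fun Q => by simp) (hwmem i)
    · intro c hc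
      rw [Fintype.sum_sum_type] at hc
      simp only [Sum.elim_inl, Sum.elim_inr] at hc
      have hmono : ∀ Q, -((P ::ₘ A).count Q : ℤ) ≤ -(A.count Q : ℤ) := fun Q => by
        have := Multiset.count_le_count_cons Q P A
        omega
      have h2 : (fun i => c (Sum.inl i)) = 0 := by
        refine H _ ?_
        have h3 := Submodule.sub_mem _ (localRR_mono hmono hc)
          (Submodule.sum_mem _ fun i (_ : i ∈ Finset.univ) =>
            Submodule.smul_mem _ (c (Sum.inr i)) (hwmem i))
        simpa using h3
      have h2' : ∀ i, c (Sum.inl i) = 0 := fun i => congrFun h2 i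
      simp only [h2', zero_smul, Finset.sum_const_zero, zero_add] at hc
      have h4 : φ (∑ i, c (Sum.inr i) • w i) = 0 := by
        rw [hφ0]
        have h5 := hc P hPS
        simp only [Multiset.count_cons_self] at h5
        convert h5 using 2
        · simp
        · push_cast
          ring
      rw [map_sum] at h4
      simp only [map_smul, hwφ] at h4
      have h6 := Fintype.linearIndependent_iff.1 b.linearIndependent _ h4
      funext i
      rcases i with i | i
      · exact h2' i
      · exact h6 i

open Classical in
/-- The fundamental inequality: the zero divisor of `h` has degree at most `[F : k(h)]`. -/
theorem sum_degree_le_finrank {h : F} (h0 : h ≠ 0) [FiniteDimensional k⟮h⟯ F]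
    (A : Multiset (PlaceOf k F)) (hA : ∀ P ∈ A, P.v h ≤ exp (-(A.count P : ℤ))) :
    (A.map PlaceOf.degree).sum ≤ Module.finrank k⟮h⟯ F := by
  have hlt : ∀ P ∈ A, P.v h < 1 := fun P hP => (hA P hP).trans_lt (by
    rw [← exp_zero, exp_lt_exp]
    have := Multiset.count_pos.2 hP
    omega)
  obtain ⟨u, hu, H⟩ := exists_independent_mod A.toFinset
    (fun P hP => P.finite_resField h0 (hlt P (Multiset.mem_toFinset.1 hP))) A
    (fun P hP => Multiset.mem_toFinset.2 hP)
  simpa using card_le_finrank_of_mod k F h0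
    (fun P hP => hA P (Multiset.mem_toFinset.1 hP)) (by simp) hu H

theorem PlaceOf.degree_pos (P : PlaceOf k F) {h : F} (h0 : h ≠ 0) (hP : P.v h < 1)
    [FiniteDimensional k⟮h⟯ F] : 0 < P.degree := by
  have := P.finite_resField h0 hP
  exact Module.finrank_pos

end FundamentalInequality

section Divisors

variable {k F : Type} [Field k] [Field F] [Algebra k F]

theorem DivisorOf.deg_add (D E : PlaceOf k F →₀ ℤ) :
    DivisorOf.deg k F (D + E) = DivisorOf.deg k F D + DivisorOf.deg k F E :=
  Finsupp.sum_add_index' (fun _ => by simp) (fun _ _ _ => by ring)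

theorem DivisorOf.deg_nsmul (m : ℕ) (D : PlaceOf k F →₀ ℤ) :
    DivisorOf.deg k F (m • D) = m * DivisorOf.deg k F D := by
  induction m with
  | zero => simp [DivisorOf.deg]
  | succ m ih =>
    rw [succ_nsmul, DivisorOf.deg_add, ih]
    push_cast
    ring

theorem DivisorOf.deg_single (P : PlaceOf k F) (m : ℤ) :
    DivisorOf.deg k F (Finsupp.single P m) = m * P.degree := by
  rw [DivisorOf.deg, Finsupp.sum_single_index (by simp)]

theorem DivisorOf.deg_mapRange (z : PlaceOf k F →₀ ℕ) :
    DivisorOf.deg k F (z.mapRange Nat.cast Nat.cast_zero) =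
      ((Finsupp.toMultiset z).map PlaceOf.degree).sum := by
  induction z using Finsupp.induction_linear with
  | zero => simp [DivisorOf.deg]
  | add f g hf hg =>
    rw [Finsupp.mapRange_add (by simp), DivisorOf.deg_add, hf, hg, map_add, Multiset.map_add,
      Multiset.sum_add, Nat.cast_add]
  | single P m => simp [DivisorOf.deg_single, Finsupp.toMultiset_single, Multiset.nsmul_singleton]

theorem finite_zeros {h : F} (h0 : h ≠ 0) [FiniteDimensional k⟮h⟯ F] :
    {P : PlaceOf k F | P.v h < 1}.Finite := by
  classical
  by_contra hinf
  obtain ⟨s, hs, hcard⟩ := Set.Infinite.exists_subset_card_eq hinf (Module.finrank k⟮h⟯ F + 1)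
  have h1 := sum_degree_le_finrank h0 s.val fun P hP => by
    rw [Multiset.count_eq_one_of_mem s.nodup hP]
    exact PlaceOf.lt_exp_iff.1 (hs hP)
  have h2 : s.card • 1 ≤ (s.val.map PlaceOf.degree).sum :=
    Finset.card_nsmul_le_sum s PlaceOf.degree 1 fun P hP => P.degree_pos h0 (hs hP)
  rw [hcard, smul_eq_mul, mul_one] at h2
  omega

/-- The divisor of zeros of a function exists, and its degree is bounded by the degree of
the function. -/
theorem exists_zeroDivisor {h : F} (h0 : h ≠ 0) [FiniteDimensional k⟮h⟯ F] :
    ∃ Z : PlaceOf k F →₀ ℤ, (∀ P, Z P = max 0 (-log (P.v h))) ∧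
      DivisorOf.deg k F Z ≤ Module.finrank k⟮h⟯ F := by
  classical
  let z : PlaceOf k F →₀ ℕ := Finsupp.onFinset (finite_zeros h0).toFinset
    (fun P => (-log (P.v h)).toNat) fun P hP => by
      rw [Set.Finite.mem_toFinset, Set.mem_ofPred_eq, ← exp_zero,
        ← log_lt_iff_lt_exp ((map_ne_zero _).2 h0)]
      omega
  have hz : ∀ P, (z P : ℤ) = max 0 (-log (P.v h)) := fun P => by
    change ((-log (P.v h)).toNat : ℤ) = _
    omega
  refine ⟨z.mapRange Nat.cast Nat.cast_zero, fun P => by simpa using hz P, ?_⟩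
  rw [DivisorOf.deg_mapRange]
  refine Nat.cast_le.2 (sum_degree_le_finrank h0 _ fun P hP => ?_)
  rw [Finsupp.count_toMultiset, hz, ← log_le_iff_le_exp ((map_ne_zero _).2 h0)]
  rw [← Multiset.count_pos, Finsupp.count_toMultiset] at hP
  have := hz P
  omega

theorem adjoin_simple_inv (x : F) : k⟮x⁻¹⟯ = k⟮x⟯ := by
  refine le_antisymm ?_ ?_
  · rw [adjoin_simple_le_iff]
    exact inv_mem (mem_adjoin_simple_self k x)
  · rw [adjoin_simple_le_iff]
    have := inv_mem (mem_adjoin_simple_self k x⁻¹)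
    rwa [inv_inv] at this

/-- The divisor of poles of a function. -/
theorem exists_poleDivisor {x : F} (h0 : x ≠ 0) [FiniteDimensional k⟮x⟯ F] :
    ∃ X : PlaceOf k F →₀ ℤ, (∀ P, X P = max 0 (log (P.v x))) ∧
      DivisorOf.deg k F X ≤ Module.finrank k⟮x⟯ F := by
  have h1 := adjoin_simple_inv (k := k) x
  have : FiniteDimensional k⟮x⁻¹⟯ F := by rwa [h1]
  obtain ⟨Z, hZ, hdeg⟩ := exists_zeroDivisor (k := k) (inv_ne_zero h0)
  refine ⟨Z, fun P => by simpa using hZ P, ?_⟩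
  rwa [h1] at hdeg

theorem localRR_add_single [DecidableEq (PlaceOf k F)] (P : PlaceOf k F)
    [Module.Finite k P.ResField] (D : PlaceOf k F → ℤ)
    [Module.Finite k (localRR Set.univ D)] :
    Module.Finite k (localRR Set.univ (D + Pi.single P 1)) ∧
      Module.finrank k (localRR Set.univ (D + Pi.single P 1)) ≤
        Module.finrank k (localRR Set.univ D) + P.degree := by
  obtain ⟨φ, -, hφ0⟩ := P.exists_leadingCoeff (D P + 1)
  have hle : localRR Set.univ (D + Pi.single P 1) ≤ localRR {P} (fun _ => D P + 1) := by
    intro f hf Q hQ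
    obtain rfl := Set.mem_singleton_iff.1 hQ
    simpa using hf Q trivial
  let ψ := φ ∘ₗ Submodule.inclusion hle
  have hker : LinearMap.ker ψ = (localRR Set.univ D).comap
      (localRR Set.univ (D + Pi.single P 1)).subtype := by
    ext f
    rw [LinearMap.mem_ker, Submodule.mem_comap]
    change φ (Submodule.inclusion hle f) = 0 ↔ (f : F) ∈ _
    rw [hφ0, add_sub_cancel_right]
    refine ⟨fun h Q _ => ?_, fun h => h P trivial⟩
    rcases eq_or_ne Q P with rfl | hQP
    · exact h
    · simpa [hQP] using f.2 Q trivial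
  have hDle : localRR Set.univ D ≤ localRR Set.univ (D + Pi.single P 1) :=
    localRR_mono fun Q => by
      rcases eq_or_ne Q P with rfl | hQP
      · simp
      · simp [hQP]
  let e : LinearMap.ker ψ ≃ₗ[k] localRR Set.univ D :=
    (LinearEquiv.ofEq _ _ hker).trans (Submodule.comapSubtypeEquivOfLe hDle)
  have hkfin : Module.Finite k (LinearMap.ker ψ) := Module.Finite.equiv e.symm
  have hfin : Module.Finite k (localRR Set.univ (D + Pi.single P 1)) := by
    rw [← Module.rank_lt_aleph0_iff, ← ψ.rank_range_add_rank_ker]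
    exact Cardinal.add_lt_aleph0 (Module.rank_lt_aleph0 _ _) (Module.rank_lt_aleph0 _ _)
  refine ⟨hfin, ?_⟩
  rw [← ψ.finrank_range_add_finrank_ker, e.finrank_eq, add_comm]
  exact Nat.add_le_add_left (Submodule.finrank_le _) _

open Classical in
theorem localRR_add_count (hres : ∀ P : PlaceOf k F, Module.Finite k P.ResField)
    (D : PlaceOf k F → ℤ) [Module.Finite k (localRR Set.univ D)]
    (A : Multiset (PlaceOf k F)) :
    Module.Finite k (localRR Set.univ (D + fun P => (A.count P : ℤ))) ∧
      Module.finrank k (localRR Set.univ (D + fun P => (A.count P : ℤ))) ≤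
        Module.finrank k (localRR Set.univ D) + (A.map PlaceOf.degree).sum := by
  induction A using Multiset.induction_on with
  | empty =>
    have h1 : (D + fun P => ((0 : Multiset (PlaceOf k F)).count P : ℤ)) = D := by
      ext; simp
    rw [h1]
    exact ⟨inferInstance, by simp⟩
  | cons P A ih =>
    obtain ⟨h1, h2⟩ := ih
    have := hres P
    obtain ⟨h3, h4⟩ := localRR_add_single P (D + fun P => (A.count P : ℤ))
    have h5 : (D + fun Q => ((P ::ₘ A).count Q : ℤ)) =
        (D + fun P => (A.count P : ℤ)) + Pi.single P 1 := by
      ext Q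
      rcases eq_or_ne Q P with rfl | hQP
      · simp [add_assoc]
      · simp [hQP]
    rw [h5, Multiset.map_cons, Multiset.sum_cons]
    exact ⟨h3, by omega⟩

/-- `deg D - ℓ(D)` is nondecreasing in `D`. -/
theorem ell_add_deg_le (hres : ∀ P : PlaceOf k F, Module.Finite k P.ResField)
    {D E : PlaceOf k F →₀ ℤ} (hDE : D ≤ E) [hD : Module.Finite k (RRSpace k F D)] :
    Module.Finite k (RRSpace k F E) ∧
      (ell k F E : ℤ) + DivisorOf.deg k F D ≤ ell k F D + DivisorOf.deg k F E := by
  classical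
  let z : PlaceOf k F →₀ ℕ := (E - D).mapRange Int.toNat rfl
  have hz : E = D + z.mapRange Nat.cast Nat.cast_zero := by
    ext P
    have := hDE P
    simp only [Finsupp.add_apply, Finsupp.mapRange_apply, Finsupp.sub_apply, z]
    omega
  have hz' : (E : PlaceOf k F → ℤ) = D + fun P => ((Finsupp.toMultiset z).count P : ℤ) := by
    rw [hz]
    ext P
    simp
  rw [RRSpace_eq_localRR] at hD
  obtain ⟨h1, h2⟩ := localRR_add_count hres D (Finsupp.toMultiset z)
  rw [← hz'] at h1 h2
  rw [ell, ell, RRSpace_eq_localRR, RRSpace_eq_localRR]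
  refine ⟨h1, ?_⟩
  rw [hz, DivisorOf.deg_add, DivisorOf.deg_mapRange, ← hz]
  omega

theorem RRSpace_mono {D E : PlaceOf k F →₀ ℤ} (h : D ≤ E) : RRSpace k F D ≤ RRSpace k F E := by
  rw [RRSpace_eq_localRR, RRSpace_eq_localRR]
  exact localRR_mono h

theorem RRSpace_finite (hres : ∀ P : PlaceOf k F, Module.Finite k P.ResField)
    [Module.Finite k (RRSpace k F 0)] (D : PlaceOf k F →₀ ℤ) :
    Module.Finite k (RRSpace k F D) := by
  have h1 : (0 : PlaceOf k F →₀ ℤ) ≤ D ⊔ 0 := le_sup_right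
  have := (ell_add_deg_le hres h1).1
  exact Submodule.finiteDimensional_of_le (RRSpace_mono (le_sup_left : D ≤ D ⊔ 0))

end Divisors

section Transcendental

open Polynomial

variable {k F : Type} [Field k] [Field F] [Algebra k F]

theorem PlaceOf.v_aeval_le_one (P : PlaceOf k F) {x : F} (hx : P.v x ≤ 1) (q : k[X]) :
    P.v (aeval x q) ≤ 1 := by
  have h1 : ∀ r ∈ localRR {P} (0 : PlaceOf k F → ℤ), x * r ∈ localRR {P} 0 := by
    rintro r hr Q rfl
    rw [map_mul]
    exact (mul_le_of_le_one_left' hx).trans (hr Q rfl)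
  have h2 : (1 : F) ∈ localRR {P} (0 : PlaceOf k F → ℤ) := by
    simpa using algebraMap_mem_localRR {P} (1 : k)
  simpa using aeval_mul_mem h1 q h2 P rfl

theorem PlaceOf.v_aeval_of_one_lt (P : PlaceOf k F) {x : F} (hx : 1 < P.v x) {q : k[X]}
    (hq : q ≠ 0) : P.v (aeval x q) = P.v x ^ q.natDegree := by
  induction hd : q.natDegree generalizing q with
  | zero =>
    rw [natDegree_eq_zero] at hd
    obtain ⟨a, rfl⟩ := hd
    rw [aeval_C, pow_zero]
    exact P.trivialOnBase a (by simpa using hq)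
  | succ d ih =>
    have h1 : (divX q).natDegree = d := by rw [natDegree_divX_eq_natDegree_tsub_one, hd]; rfl
    have h2 : divX q ≠ 0 := by
      intro h
      rw [divX_eq_zero_iff] at h
      rw [h, natDegree_C] at hd
      omega
    have h3 : P.v (aeval x (divX q) * x) = P.v x ^ (d + 1) := by
      rw [map_mul, ih h2 h1, pow_succ]
    conv_lhs => rw [← divX_mul_X_add q]
    rw [map_add, map_mul, aeval_X, aeval_C, Valuation.map_add_eq_of_lt_left, h3]
    rw [h3]
    exact (P.v_algebraMap_le _).trans_lt (one_lt_pow₀ hx (by omega))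

/-- A place that is not a pole of `x` lies above a finite place of `k(x)`. -/
theorem PlaceOf.exists_v_aeval_lt_one (P : PlaceOf k F) {x : F} [FiniteDimensional k⟮x⟯ F]
    (hx : P.v x ≤ 1) : ∃ q : k[X], q ≠ 0 ∧ P.v (aeval x q) < 1 := by
  by_contra! hcon
  have h1 : ∀ y ∈ k⟮x⟯, P.v y ≤ 1 := by
    intro y hy
    obtain ⟨r, s, rfl⟩ := (mem_adjoin_simple_iff k y).1 hy
    rcases eq_or_ne s 0 with rfl | hs
    · simp
    · rw [map_div₀]
      have h2 := hcon s hs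
      exact div_le_one_of_le₀ ((P.v_aeval_le_one hx r).trans h2) zero_le
  obtain ⟨y, hy⟩ := P.surjective (exp 1)
  let j : k⟮x⟯ →+* P.v.valuationSubring :=
    (algebraMap k⟮x⟯ F).codRestrict P.v.valuationSubring.toSubring fun z => h1 z z.2
  have hxint : IsIntegral P.v.valuationSubring y := by
    obtain ⟨p, hp, hpy⟩ := Algebra.IsIntegral.isIntegral (R := k⟮x⟯) y
    refine ⟨p.map j, hp.map j, ?_⟩
    rw [eval₂_map]
    exact hpy
  obtain ⟨z, hz⟩ := IsIntegrallyClosed.isIntegral_iff.1 hxint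
  have h3 : P.v y ≤ 1 := by
    rw [← hz]
    exact z.2
  rw [hy, ← exp_zero, exp_le_exp] at h3
  omega

theorem finrank_le_natDegree_mul {L : Type} [Field L] [Algebra L F] {x : F}
    [FiniteDimensional L⟮x⟯ F] {p : L[X]} (hp : p ≠ 0) (hpx : aeval x p = 0) :
    FiniteDimensional L F ∧
      Module.finrank L F ≤ p.natDegree * Module.finrank L⟮x⟯ F := by
  have hxint : IsIntegral L x := IsAlgebraic.isIntegral ⟨p, hp, hpx⟩
  have hfin : FiniteDimensional L L⟮x⟯ := adjoin.finiteDimensional hxint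
  refine ⟨FiniteDimensional.trans L L⟮x⟯ F, ?_⟩
  rw [← Module.finrank_mul_finrank L L⟮x⟯ F, adjoin.finrank hxint]
  exact Nat.mul_le_mul_right _ (natDegree_le_of_dvd (minpoly.dvd L x hpx) hp)

theorem finrank_adjoin_aeval (x : F) [FiniteDimensional k⟮x⟯ F] {q : k[X]}
    (hq : 1 ≤ q.natDegree) : FiniteDimensional k⟮aeval x q⟯ F ∧
      Module.finrank k⟮aeval x q⟯ F ≤ q.natDegree * Module.finrank k⟮x⟯ F := by
  set h := aeval x q with hh
  let L := k⟮h⟯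
  have hE : (L⟮x⟯).restrictScalars k = k⟮x⟯ := by
    rw [adjoin_simple_adjoin_simple]
    refine le_antisymm (adjoin_le_iff.2 ?_) (adjoin.mono _ _ _ (by simp))
    rintro y (rfl | rfl)
    · exact algebra_adjoin_le_adjoin k _ (aeval_mem_adjoin_singleton k x)
    · exact mem_adjoin_simple_self k _
  have hfin : FiniteDimensional ((L⟮x⟯).restrictScalars k) F := by rwa [hE]
  have hfin' : FiniteDimensional L⟮x⟯ F := hfin
  have hrank : Module.finrank L⟮x⟯ F = Module.finrank k⟮x⟯ F := by
    rw [← hE]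
    rfl
  let p : L[X] := q.map (algebraMap k L) - C (AdjoinSimple.gen k h)
  have hpdeg : p.natDegree = q.natDegree := by
    rw [natDegree_sub_C, natDegree_map]
  have hp0 : p ≠ 0 := by
    intro h0
    rw [h0, natDegree_zero] at hpdeg
    omega
  have hpx : aeval x p = 0 := by
    rw [map_sub, aeval_map_algebraMap, aeval_C, AdjoinSimple.algebraMap_gen, ← hh, sub_self]
  have h1 := finrank_le_natDegree_mul hp0 hpx
  rwa [hrank, hpdeg] at h1

theorem exists_aeval_le (x : F) [FiniteDimensional k⟮x⟯ F] (D : PlaceOf k F →₀ ℤ) :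
    ∃ q : k[X], 1 ≤ q.natDegree ∧ ∀ P : PlaceOf k F, P.v x ≤ 1 →
      P.v (aeval x q) ≤ exp (-D P) := by
  classical
  have key : ∀ S : Finset (PlaceOf k F), ∃ q : k[X], q ≠ 0 ∧ ∀ P ∈ S, P.v x ≤ 1 →
      P.v (aeval x q) ≤ exp (-D P) := by
    intro S
    induction S using Finset.induction_on with
    | empty => exact ⟨1, one_ne_zero, by simp⟩
    | insert P S hPS ih =>
      obtain ⟨q, hq0, hq⟩ := ih
      by_cases hP : P.v x ≤ 1
      · obtain ⟨r, hr0, hr⟩ := P.exists_v_aeval_lt_one hP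
        obtain ⟨N, hN⟩ := exists_pow_mul_lt_one hr (exp (D P))
        refine ⟨r ^ N * q, mul_ne_zero (pow_ne_zero _ hr0) hq0, fun Q hQ hQx => ?_⟩
        rw [map_mul, map_mul]
        rcases Finset.mem_insert.1 hQ with rfl | hQ
        · refine (mul_le_of_le_one_right' (Q.v_aeval_le_one hQx _)).trans ?_
          have h1 := hN N le_rfl
          rw [map_pow, map_pow, exp_neg, ← one_mul (exp (D Q))⁻¹, le_mul_inv_iff₀ exp_pos]
          exact h1.le
        · exact (mul_le_of_le_one_left' (Q.v_aeval_le_one hQx _)).trans (hq Q hQ hQx)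
      · refine ⟨q, hq0, fun Q hQ hQx => ?_⟩
        rcases Finset.mem_insert.1 hQ with rfl | hQ
        · exact absurd hQx hP
        · exact hq Q hQ hQx
  obtain ⟨q, hq0, hq⟩ := key D.support
  refine ⟨X * q, by rw [natDegree_X_mul hq0]; omega, fun P hP => ?_⟩
  by_cases hPD : P ∈ D.support
  · rw [map_mul, map_mul]
    exact (mul_le_of_le_one_left' (P.v_aeval_le_one hP _)).trans (hq P hPD hP)
  · rw [Finsupp.notMem_support_iff.1 hPD, neg_zero, exp_zero]
    exact P.v_aeval_le_one hP _

theorem PlaceOf.exists_local_parameter (P : PlaceOf k F) {x : F} (hx : Transcendental k x)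
    [FiniteDimensional k⟮x⟯ F] :
    ∃ h : F, h ≠ 0 ∧ P.v h < 1 ∧ FiniteDimensional k⟮h⟯ F := by
  rcases le_or_gt (P.v x) 1 with h1 | h1
  · obtain ⟨q, hq0, hq⟩ := P.exists_v_aeval_lt_one h1
    refine ⟨aeval x q, fun h => hx ⟨q, hq0, h⟩, hq, (finrank_adjoin_aeval x ?_).1⟩
    by_contra hdeg
    obtain ⟨a, rfl⟩ := natDegree_eq_zero.1 (by omega : q.natDegree = 0)
    rw [aeval_C, P.trivialOnBase a (by simpa using hq0)] at hq
    exact lt_irrefl _ hq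
  · have hx0 : x ≠ 0 := by
      rintro rfl
      simp at h1
    refine ⟨x⁻¹, inv_ne_zero hx0, ?_, ?_⟩
    · rw [map_inv₀]
      exact inv_lt_one_of_one_lt₀ h1
    · rwa [adjoin_simple_inv]

theorem linearIndependent_pow_of_transcendental {x : F} (hx : Transcendental k x) :
    LinearIndependent k fun j : ℕ => x ^ j := by
  have h1 := (basisMonomials k).linearIndependent.map' (aeval x).toLinearMap
    (LinearMap.ker_eq_bot.2 (transcendental_iff_injective.1 hx))
  have h2 : (aeval x).toLinearMap ∘ basisMonomials k = fun j : ℕ => x ^ j := by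
    ext j
    simp
  rwa [h2] at h1

end Transcendental

section RiemannBound

open Polynomial

variable {k F : Type} [Field k] [Field F] [Algebra k F]

theorem finite_resField_of_transcendental {x : F} (hx : Transcendental k x)
    [FiniteDimensional k⟮x⟯ F] (P : PlaceOf k F) : Module.Finite k P.ResField := by
  obtain ⟨h, h0, hP, hfin⟩ := P.exists_local_parameter hx
  exact P.finite_resField h0 hP

theorem inv_aeval_mul_pow_mem {x : F} {q : k[X]} (hq : aeval x q ≠ 0)
    {Z X : PlaceOf k F →₀ ℤ} (hZ : ∀ P, Z P = max 0 (-log (P.v (aeval x q))))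
    (hX : ∀ P, X P = max 0 (log (P.v x))) {N j : ℕ} (hj : j ≤ N + q.natDegree) :
    (aeval x q)⁻¹ * x ^ j ∈ localRR Set.univ (Z + N • X) := by
  intro P _
  have h0 : P.v (aeval x q) ≠ 0 := (_root_.map_ne_zero _).2 hq
  rw [map_mul, map_inv₀, map_pow, Finsupp.add_apply, Finsupp.smul_apply, hZ, hX]
  rcases le_or_gt (P.v x) 1 with h1 | h1
  · refine (mul_le_of_le_one_right' (pow_le_one' h1 j)).trans ?_
    rw [← exp_log h0, ← exp_neg, exp_le_exp, log_exp, nsmul_eq_mul]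
    have h2 : (0 : ℤ) ≤ N * max 0 (log (P.v x)) := by positivity
    omega
  · have hx0 : P.v x ≠ 0 := (zero_lt_one.trans h1).ne'
    have hq0 : q ≠ 0 := by
      rintro rfl
      simp at hq
    rw [P.v_aeval_of_one_lt h1 hq0, ← exp_log hx0]
    have hm : 0 < log (P.v x) := by
      rwa [← exp_log hx0, ← exp_zero, exp_lt_exp] at h1
    generalize log (P.v x) = m at hm
    simp only [← exp_nsmul, ← exp_neg, ← exp_add, log_exp]
    rw [exp_le_exp]
    simp only [nsmul_eq_mul]
    rw [max_eq_right hm.le]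
    have h3 : (j : ℤ) * m ≤ (N + q.natDegree : ℕ) * m :=
      mul_le_mul_of_nonneg_right (by exact_mod_cast hj) hm.le
    have h4 : 0 ≤ max 0 (-((q.natDegree : ℤ) * m)) := le_max_left _ _
    push_cast at h3
    linarith

theorem finrank_mul_le_ell {x : F} (hx : Transcendental k x) [FiniteDimensional k⟮x⟯ F]
    {B E : PlaceOf k F →₀ ℤ} (hB : Submodule.span k⟮x⟯ (RRSpace k F B : Set F) = ⊤)
    [Module.Finite k (RRSpace k F E)] {h : F} (h0 : h ≠ 0) (M : ℕ)
    (hE : ∀ b ∈ RRSpace k F B, ∀ j < M, h * x ^ j * b ∈ RRSpace k F E) :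
    M * Module.finrank k⟮x⟯ F ≤ ell k F E := by
  obtain ⟨b, hbB, hspan, hli⟩ := exists_linearIndependent k⟮x⟯ (RRSpace k F B : Set F)
  have : Fintype b := hli.setFinite.fintype
  have hcard : Module.finrank k⟮x⟯ F = Fintype.card b := by
    refine Module.finrank_eq_card_basis (Module.Basis.mk hli ?_)
    rw [Subtype.range_coe_subtype, Set.ofPred_mem_eq, hspan, hB]
  have hx' : Transcendental k (AdjoinSimple.gen k x) := by
    intro halg
    apply hx
    have := halg.algebraMap (A := F)
    rwa [AdjoinSimple.algebraMap_gen] at this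
  have h1 := (linearIndependent_pow_of_transcendental hx').comp (Fin.val : Fin M → ℕ)
    Fin.val_injective
  have h2 := (linearIndependent_smul h1 hli).map' (LinearMap.mulLeft k h)
    (LinearMap.ker_eq_bot.2 (mul_right_injective₀ h0))
  let φ : Fin M × b → RRSpace k F E := fun p => ⟨h * x ^ (p.1 : ℕ) * p.2, hE _ (hbB p.2.2) _ p.1.2⟩
  have h3 : LinearIndependent k φ := by
    refine LinearIndependent.of_comp (RRSpace k F E).subtype ?_
    have h5 : (RRSpace k F E).subtype ∘ φ = LinearMap.mulLeft k h ∘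
        fun p : Fin M × b => AdjoinSimple.gen k x ^ (p.1 : ℕ) • (p.2 : F) := by
      ext p
      simp [φ, Algebra.smul_def, mul_assoc]
    rwa [h5]
  have h4 := h3.fintype_card_le_finrank
  rwa [Fintype.card_prod, Fintype.card_fin, ← hcard] at h4

/-- A form of Riemann's inequality. -/
theorem deg_add_finrank_le {x : F} (hx : Transcendental k x) [FiniteDimensional k⟮x⟯ F]
    [Module.Finite k (RRSpace k F 0)] {B : PlaceOf k F →₀ ℤ} (hB0 : 0 ≤ B)
    (hB : Submodule.span k⟮x⟯ (RRSpace k F B : Set F) = ⊤) (D : PlaceOf k F →₀ ℤ) :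
    DivisorOf.deg k F D + Module.finrank k⟮x⟯ F ≤ ell k F D + DivisorOf.deg k F B := by
  have hres := finite_resField_of_transcendental hx
  obtain ⟨q, hq1, hq⟩ := exists_aeval_le x D
  have hh0 : aeval x q ≠ 0 := fun h => hx ⟨q, by rintro rfl; simp at hq1, h⟩
  have hx0 : x ≠ 0 := by
    rintro rfl
    exact hx isAlgebraic_zero
  obtain ⟨hfin, hrank⟩ := finrank_adjoin_aeval x hq1
  obtain ⟨Z, hZ, hZdeg⟩ := exists_zeroDivisor (k := k) hh0
  obtain ⟨X, hX, hXdeg⟩ := exists_poleDivisor (k := k) hx0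
  let N : ℕ := D.support.sup fun P => (D P).toNat
  have hDE : D ≤ Z + N • X + B := by
    intro P
    have hBP : 0 ≤ B P := hB0 P
    rw [Finsupp.add_apply, Finsupp.add_apply, Finsupp.smul_apply, hZ, hX, nsmul_eq_mul]
    rcases le_or_gt (P.v x) 1 with h1 | h1
    · have h2 := hq P h1
      rw [← log_le_iff_le_exp ((_root_.map_ne_zero _).2 hh0)] at h2
      have h3 : (0 : ℤ) ≤ N * max 0 (log (P.v x)) := by positivity
      omega
    · have hlog : 1 ≤ log (P.v x) := by
        rwa [← exp_zero, ← lt_log_iff_exp_lt ((zero_lt_one.trans h1).ne')] at h1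
      have h2 : D P ≤ N := by
        by_cases hP : P ∈ D.support
        · have := Finset.le_sup (f := fun P => (D P).toNat) hP
          change (D P).toNat ≤ N at this
          omega
        · rw [Finsupp.notMem_support_iff.1 hP]
          omega
      have h3 : (N : ℤ) * 1 ≤ N * max 0 (log (P.v x)) :=
        mul_le_mul_of_nonneg_left (by omega) (by omega)
      omega
  have hfinD := RRSpace_finite hres D
  obtain ⟨hfinE, hmono⟩ := ell_add_deg_le hres hDE
  have h1 : (N + q.natDegree + 1) * Module.finrank k⟮x⟯ F ≤ ell k F (Z + N • X + B) := by
    refine finrank_mul_le_ell hx hB (inv_ne_zero hh0) _ fun b hb j hj => ?_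
    rw [RRSpace_eq_localRR] at hb ⊢
    exact mul_mem_localRR (inv_aeval_mul_pow_mem hh0 hZ hX (by omega)) hb
  rw [DivisorOf.deg_add, DivisorOf.deg_add, DivisorOf.deg_nsmul] at hmono
  have h2 : (N : ℤ) * DivisorOf.deg k F X ≤ N * Module.finrank k⟮x⟯ F :=
    mul_le_mul_of_nonneg_left hXdeg (by omega)
  zify at h1 hrank
  linarith

end RiemannBound

section GeneratorBound

variable {k F : Type} [Field k] [Field F] [Algebra k F]

open scoped IntermediateField.algebraAdjoinAdjoin in
/-- Algebraic elements that are independent over `k` stay independent over a purely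
transcendental extension `k(x)`. -/
theorem linearIndependent_adjoin_of_isAlgebraic {x : F} (hx : Transcendental k x) {ι : Type}
    {b : ι → F} (hb : LinearIndependent k b) (halg : ∀ i, IsAlgebraic k (b i)) :
    LinearIndependent k⟮x⟯ b := by
  rw [← LinearIndependent.iff_fractionRing (Algebra.adjoin k {x})]
  rw [linearIndependent_iff']
  intro s g hg i hi
  have hp : ∀ j, ∃ p : Polynomial k, Polynomial.aeval x p = (g j : F) := by
    intro j
    obtain ⟨y, hy⟩ := g j
    rwa [Algebra.adjoin_singleton_eq_range_aeval] at hy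
  choose p hp using hp
  let a : ι → algebraicClosure k F := fun j => ⟨b j, mem_algebraicClosure_iff.2 (halg j)⟩
  let Q : Polynomial (algebraicClosure k F) :=
    ∑ j ∈ s, (p j).map (algebraMap k (algebraicClosure k F)) * Polynomial.C (a j)
  have hQ : Polynomial.aeval x Q = 0 := by
    rw [map_sum, ← hg]
    refine Finset.sum_congr rfl fun j _ => ?_
    rw [map_mul, Polynomial.aeval_map_algebraMap, hp, Polynomial.aeval_C]
    rfl
  have hQ0 : Q = 0 := by
    by_contra h
    exact hx.algebraicClosure ⟨Q, h, hQ⟩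
  have hcoeff : ∀ m, (p i).coeff m = 0 := by
    intro m
    refine linearIndependent_iff'.1 hb s (fun j => (p j).coeff m) ?_ i hi
    have h1 := congrArg (fun R => algebraMap (algebraicClosure k F) F (R.coeff m)) hQ0
    simp only [Q, Polynomial.finsetSum_coeff, Polynomial.coeff_mul_C, Polynomial.coeff_map,
      map_sum, map_mul, Polynomial.coeff_zero, map_zero] at h1
    rw [← h1]
    refine Finset.sum_congr rfl fun j _ => ?_
    rw [Algebra.smul_def]
    rfl
  have hpi : p i = 0 := Polynomial.ext hcoeff
  apply Subtype.ext
  rw [← hp i, hpi, map_zero]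
  rfl

variable (k F) in
/-- The field of constants: the functions without poles. -/
noncomputable def constants : Subalgebra k F where
  carrier := RRSpace k F 0
  mul_mem' := by
    intro a b ha hb
    rw [RRSpace_eq_localRR] at *
    simpa using mul_mem_localRR ha hb
  add_mem' := (RRSpace k F 0).add_mem
  algebraMap_mem' c := by
    rw [RRSpace_eq_localRR]
    exact algebraMap_mem_localRR _ c

theorem exists_intermediateField_constants {x : F} (hx : Transcendental k x)
    [Module.Finite k (RRSpace k F 0)] :
    ∃ E : IntermediateField k⟮x⟯ F, Module.finrank k⟮x⟯ E = ell k F 0 ∧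
      ∀ y ∈ E, y ∈ Submodule.span k⟮x⟯ (RRSpace k F 0 : Set F) := by
  have hfin : Module.Finite k (constants k F) := ‹Module.Finite k (RRSpace k F 0)›
  have halg : ∀ y ∈ (RRSpace k F 0 : Set F), IsAlgebraic k y := by
    intro y hy
    exact (Algebra.IsIntegral.isIntegral (R := k) (⟨y, hy⟩ : constants k F)).isAlgebraic.algebraMap
  have h1 : (adjoin k⟮x⟯ (RRSpace k F 0 : Set F)).toSubalgebra.toSubmodule =
      Submodule.span k⟮x⟯ (RRSpace k F 0 : Set F) := by
    rw [adjoin_toSubalgebra_of_isAlgebraic fun y hy => (halg y hy).tower_top _,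
      Algebra.adjoin_eq_span]
    congr 1
    exact congrArg _ (Submonoid.closure_eq (constants k F).toSubmonoid)
  refine ⟨adjoin k⟮x⟯ (RRSpace k F 0 : Set F), ?_, fun y hy => h1 ▸ hy⟩
  change Module.finrank k⟮x⟯ (Subalgebra.toSubmodule
    (adjoin k⟮x⟯ (RRSpace k F 0 : Set F)).toSubalgebra) = _
  rw [h1]
  let b := Module.finBasis k (RRSpace k F 0)
  have h2 : LinearIndependent k fun i => (b i : F) :=
    b.linearIndependent.map' (RRSpace k F 0).subtype (Submodule.ker_subtype _)
  have h3 := linearIndependent_adjoin_of_isAlgebraic hx h2 fun i => halg _ (b i).2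
  have h4 : Submodule.span k (Set.range fun i => (b i : F)) = RRSpace k F 0 := by
    have := congrArg (Submodule.map (RRSpace k F 0).subtype) b.span_eq
    rwa [Submodule.map_span, ← Set.range_comp, Submodule.map_top, Submodule.range_subtype] at this
  have h5 : Submodule.span k⟮x⟯ (RRSpace k F 0 : Set F) =
      Submodule.span k⟮x⟯ (Set.range fun i => (b i : F)) := by
    conv_lhs => rw [← h4, Submodule.span_span_of_tower]
  rw [h5, finrank_span_eq_card h3, Fintype.card_fin]
  rfl

theorem pow_mem_localRR {f : F} {X : PlaceOf k F →₀ ℤ} (hX : ∀ P, X P = max 0 (log (P.v f)))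
    {d i : ℕ} (hi : i ≤ d) : f ^ i ∈ localRR Set.univ (d • X) := by
  intro P _
  rw [map_pow, Finsupp.smul_apply, hX, nsmul_eq_mul]
  rcases le_or_gt (P.v f) 1 with h1 | h1
  · refine (pow_le_one' h1 i).trans ?_
    rw [← exp_zero, exp_le_exp]
    positivity
  · have h0 : P.v f ≠ 0 := (zero_lt_one.trans h1).ne'
    have hm : 0 < log (P.v f) := by
      rwa [← exp_log h0, ← exp_zero, exp_lt_exp] at h1
    rw [← exp_log h0, ← exp_nsmul, exp_le_exp, log_exp, max_eq_right hm.le, nsmul_eq_mul]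
    exact mul_le_mul_of_nonneg_right (by exact_mod_cast hi) hm.le

theorem exists_intermediateField_insert {x : F} [FiniteDimensional k⟮x⟯ F]
    (E : IntermediateField k⟮x⟯ F) {B : PlaceOf k F →₀ ℤ}
    (hE : ∀ y ∈ E, y ∈ Submodule.span k⟮x⟯ (RRSpace k F B : Set F))
    {f : F} {X : PlaceOf k F →₀ ℤ} (hX : ∀ P, X P = max 0 (log (P.v f))) :
    ∃ (E' : IntermediateField k⟮x⟯ F) (d : ℕ), E ≤ E' ∧ f ∈ E' ∧ 1 ≤ d ∧
      Module.finrank k⟮x⟯ E' = Module.finrank k⟮x⟯ E * d ∧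
      ∀ y ∈ E', y ∈ Submodule.span k⟮x⟯ (RRSpace k F (B + (d - 1) • X) : Set F) := by
  have hxint : IsIntegral E f := Algebra.IsIntegral.isIntegral f
  refine ⟨(E⟮f⟯).restrictScalars k⟮x⟯, Module.finrank E E⟮f⟯, ?_, mem_adjoin_simple_self E f, ?_,
    (Module.finrank_mul_finrank k⟮x⟯ E E⟮f⟯).symm, ?_⟩
  · exact fun y hy => E⟮f⟯.algebraMap_mem ⟨y, hy⟩
  · exact Module.finrank_pos
  intro y hy
  let pb := adjoin.powerBasis hxint
  have hd : pb.dim = Module.finrank E E⟮f⟯ := pb.finrank.symm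
  have h1 := congrArg Subtype.val (pb.basis.sum_repr ⟨y, hy⟩)
  change _ = y at h1
  rw [← h1, ← hd]
  change E⟮f⟯.val _ ∈ _
  rw [map_sum]
  refine Submodule.sum_mem _ fun i _ => ?_
  rw [map_smul, pb.basis_eq_pow, map_pow, adjoin.powerBasis_gen]
  have h2 := hE _ (pb.basis.repr ⟨y, hy⟩ i).2
  change ((pb.basis.repr ⟨y, hy⟩ i : E) : F) * f ^ (i : ℕ) ∈ _
  generalize ((pb.basis.repr ⟨y, hy⟩ i : E) : F) = z at h2
  have h3 := Submodule.mem_map_of_mem (f := LinearMap.mulRight k⟮x⟯ (f ^ (i : ℕ))) h2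
  rw [Submodule.map_span] at h3
  refine Submodule.span_mono ?_ h3
  rintro _ ⟨w, hw, rfl⟩
  simp only [SetLike.mem_coe, RRSpace_eq_localRR] at hw ⊢
  exact mul_mem_localRR hw (pow_mem_localRR hX (by have := i.2; omega))

theorem exists_intermediateField_finset {x : F} (hx : Transcendental k x)
    [FiniteDimensional k⟮x⟯ F] [Module.Finite k (RRSpace k F 0)] (n : ℕ) (T : Finset F)
    (hT : ∀ f ∈ T, f ≠ 0 ∧ FiniteDimensional k⟮f⟯ F ∧ Module.finrank k⟮f⟯ F ≤ n) :
    ∃ (E : IntermediateField k⟮x⟯ F) (B : PlaceOf k F →₀ ℤ) (e : ℕ), (T : Set F) ⊆ E ∧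
      0 ≤ B ∧ 1 ≤ e ∧ Module.finrank k⟮x⟯ E = ell k F 0 * e ∧
      DivisorOf.deg k F B ≤ n * (e - 1) ∧
      ∀ y ∈ E, y ∈ Submodule.span k⟮x⟯ (RRSpace k F B : Set F) := by
  classical
  induction T using Finset.induction_on with
  | empty =>
    obtain ⟨E, hrank, hE⟩ := exists_intermediateField_constants (k := k) hx
    exact ⟨E, 0, 1, by simp, le_rfl, le_rfl, by simpa using hrank, by simp [DivisorOf.deg], hE⟩
  | insert f T hf ih =>
    obtain ⟨E, B, e, hTE, hB, he, hrank, hdeg, hspan⟩ :=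
      ih fun g hg => hT g (Finset.mem_insert_of_mem hg)
    obtain ⟨hf0, hffin, hfn⟩ := hT f (Finset.mem_insert_self f T)
    obtain ⟨X, hX, hXdeg⟩ := exists_poleDivisor (k := k) hf0
    obtain ⟨E', d, hEE', hfE', hd, hrank', hspan'⟩ := exists_intermediateField_insert E hspan hX
    refine ⟨E', B + (d - 1) • X, e * d, ?_, ?_, Nat.mul_pos he hd, ?_, ?_, hspan'⟩
    · rw [Finset.coe_insert, Set.insert_subset_iff]
      exact ⟨hfE', hTE.trans hEE'⟩
    · intro P
      have h1 : 0 ≤ B P := hB P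
      have h2 : 0 ≤ X P := by simp [hX]
      rw [Finsupp.add_apply, Finsupp.smul_apply]
      exact add_nonneg h1 (nsmul_nonneg h2 _)
    · rw [hrank', hrank, mul_assoc]
    · rw [DivisorOf.deg_add, DivisorOf.deg_nsmul, Nat.cast_sub hd]
      have h1 : DivisorOf.deg k F X ≤ n := hXdeg.trans (by exact_mod_cast hfn)
      zify at he hd
      have h2 : ((d : ℤ) - 1) * DivisorOf.deg k F X ≤ (d - 1) * n :=
        mul_le_mul_of_nonneg_left h1 (by omega)
      have h3 : 0 ≤ ((n : ℤ) * (e - 1)) * (d - 1) :=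
        mul_nonneg (mul_nonneg (by omega) (by omega)) (by omega)
      push_cast
      linarith

theorem deg_add_ell_le {x : F} (hx : Transcendental k x) [FiniteDimensional k⟮x⟯ F]
    [Module.Finite k (RRSpace k F 0)] (T : Finset F)
    (hT : ∀ f ∈ T, f ≠ 0 ∧ FiniteDimensional k⟮f⟯ F ∧
      Module.finrank k⟮f⟯ F ≤ Module.finrank k⟮x⟯ F)
    (htop : adjoin k (T : Set F) = ⊤) (D : PlaceOf k F →₀ ℤ) :
    DivisorOf.deg k F D + ell k F 0 ≤
      ell k F D + ((Module.finrank k⟮x⟯ F - 1) ^ 2 : ℕ) := by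
  obtain ⟨E, B, e, hTE, hB, he, hrank, hdeg, hspan⟩ := exists_intermediateField_finset hx _ T hT
  have hE : ∀ y, y ∈ E := by
    have h1 : adjoin k (T : Set F) ≤ E.restrictScalars k := adjoin_le_iff.2 hTE
    rw [htop] at h1
    exact fun y => h1 mem_top
  have hEtop : E = ⊤ := eq_top_iff.2 fun y _ => hE y
  have h1 := deg_add_finrank_le hx hB
    (eq_top_iff.2 fun y _ => hspan y (hE y)) D
  have hn : Module.finrank k⟮x⟯ F = ell k F 0 * e := by
    rw [← hrank, hEtop, finrank_top']
  have hpos : 0 < Module.finrank k⟮x⟯ F := Module.finrank_pos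
  rw [Nat.cast_pow, Nat.cast_sub hpos]
  rw [hn] at h1 hdeg hpos ⊢
  have hc : 1 ≤ ell k F 0 := Nat.pos_of_mul_pos_right hpos
  generalize ell k F 0 = c at *
  zify at hc he
  push_cast at *
  have h2 : (c : ℤ) * (e - 1) ≤ c * e - 1 := by linarith
  have h3 : ((c : ℤ) * (e - 1)) ^ 2 ≤ (c * e - 1) ^ 2 :=
    pow_le_pow_left₀ (mul_nonneg (by omega) (by omega)) h2 2
  have h4 : 0 ≤ ((c : ℤ) - 1) * (c * (e - 1) ^ 2) :=
    mul_nonneg (by omega) (mul_nonneg (by omega) (sq_nonneg _))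
  linarith

/-- A curve whose function field is generated by functions of degree at most the degree `n` of
`x` has genus at most `(n - 1)²`. -/
theorem genus_le {x : F} (hx : Transcendental k x) [FiniteDimensional k⟮x⟯ F] (T : Finset F)
    (hT : ∀ f ∈ T, f ≠ 0 ∧ FiniteDimensional k⟮f⟯ F ∧
      Module.finrank k⟮f⟯ F ≤ Module.finrank k⟮x⟯ F)
    (htop : adjoin k (T : Set F) = ⊤) : genus k F ≤ (Module.finrank k⟮x⟯ F - 1) ^ 2 := by
  by_cases hfin : Module.Finite k (RRSpace k F 0)
  · refine csSup_le' ?_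
    rintro g ⟨D, hg⟩
    have := deg_add_ell_le hx T hT htop D
    omega
  · have hell : ∀ D : PlaceOf k F →₀ ℤ, 0 ≤ D → ell k F D = 0 := by
      intro D hD
      refine Module.finrank_of_infinite_dimensional fun h => hfin ?_
      exact Submodule.finiteDimensional_of_le (RRSpace_mono hD)
    by_cases hP : Nonempty (PlaceOf k F)
    · obtain ⟨P⟩ := hP
      obtain ⟨h, h0, hPh, hh⟩ := P.exists_local_parameter hx
      have hdeg := P.degree_pos h0 hPh
      refine (Nat.sSup_of_not_bddAbove ?_).trans_le (Nat.zero_le _)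
      rintro ⟨M, hM⟩
      have h1 : (M + 1) * P.degree ∈ {g : ℕ | ∃ D : PlaceOf k F →₀ ℤ,
          (g : ℤ) + ell k F D = DivisorOf.deg k F D + ell k F 0} := by
        refine ⟨Finsupp.single P (M + 1 : ℕ), ?_⟩
        rw [hell _ (Finsupp.single_nonneg.2 (by omega)), hell 0 le_rfl, DivisorOf.deg_single]
        push_cast
        ring
      have h2 := hM h1
      have h3 : (M + 1) * 1 ≤ (M + 1) * P.degree := Nat.mul_le_mul_left _ hdeg
      omega
    · refine csSup_le' ?_
      rintro g ⟨D, hg⟩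
      have hD : D = 0 := by
        ext P
        exact absurd ⟨P⟩ hP
      rw [hD] at hg
      simp only [DivisorOf.deg, Finsupp.sum_zero_index] at hg
      omega

end GeneratorBound

section GroupAction

variable {k F : Type} [Field k] [Field F] [Algebra k F]

/-- The degree of a function is invariant under automorphisms of the function field. -/
theorem finrank_adjoin_apply (σ : F ≃ₐ[k] F) (f : F) :
    Module.finrank k⟮σ f⟯ F = Module.finrank k⟮f⟯ F := by
  have h1 : k⟮f⟯.map σ.toAlgHom = k⟮σ f⟯ := by
    rw [adjoin_map, Set.image_singleton]
    rfl
  rw [← h1]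
  exact (Algebra.finrank_eq_of_equiv_equiv (intermediateFieldMap σ k⟮f⟯).toRingEquiv
    σ.toRingEquiv (by ext; rfl)).symm

/-- The degree of a function on a curve dominated by another one is at most the degree of its
pullback. -/
theorem finrank_adjoin_subtype_le {E : IntermediateField k F} {f : E}
    [FiniteDimensional k⟮(f : F)⟯ F] : FiniteDimensional k⟮f⟯ E ∧
      Module.finrank k⟮f⟯ E ≤ Module.finrank k⟮(f : F)⟯ F := by
  have h1 : Module.finrank k⟮f⟯ F = Module.finrank k⟮(f : F)⟯ F := by
    rw [← lift_adjoin_simple]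
    exact Algebra.finrank_eq_of_equiv_equiv (liftAlgEquiv k⟮f⟯).toRingEquiv
      (RingEquiv.refl F) (by ext; rfl)
  have hfin : FiniteDimensional k⟮f⟯ F := by
    refine FiniteDimensional.of_finrank_pos ?_
    rw [h1]
    exact Module.finrank_pos
  have hfinE : FiniteDimensional k⟮f⟯ E := FiniteDimensional.left k⟮f⟯ E F
  have hfinF : FiniteDimensional E F := FiniteDimensional.right k⟮f⟯ E F
  have hfree : Module.Free k⟮f⟯ E := Module.Free.of_divisionRing _ _
  have hfree' : Module.Free E F := Module.Free.of_divisionRing _ _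
  refine ⟨hfinE, ?_⟩
  rw [← h1, ← Module.finrank_mul_finrank k⟮f⟯ E F]
  exact Nat.le_mul_of_pos_right _ Module.finrank_pos

/-- The restriction of a group action to an invariant intermediate field. -/
noncomputable def restrictAction {G : Type} [Group G] (ρ : G →* (F ≃ₐ[k] F))
    (E : IntermediateField k F) (hE : ∀ g, ∀ y ∈ E, ρ g y ∈ E) : G →* (E ≃ₐ[k] E) where
  toFun g :=
    { toFun := fun y => ⟨ρ g y, hE g y y.2⟩
      invFun := fun y => ⟨ρ g⁻¹ y, hE g⁻¹ y y.2⟩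
      left_inv := fun y => by
        ext
        simp
      right_inv := fun y => by
        ext
        simp
      map_mul' := fun y z => by
        ext
        simp
      map_add' := fun y z => by
        ext
        simp
      commutes' := fun c => by
        ext
        exact (ρ g).commutes c }
  map_one' := by
    ext
    simp
  map_mul' g h := by
    ext
    simp

theorem card_dvd_finrank_of_fixed {G : Type} [Group G] [Finite G] (ρ : G →* (F ≃ₐ[k] F))
    (hρ : Function.Injective ρ) {f : F} (hf : ∀ g, ρ g f = f) [FiniteDimensional k⟮f⟯ F] :
    Nat.card G ∣ Module.finrank k⟮f⟯ F := by
  have : Finite ρ.range := Finite.of_equiv G (ρ.ofInjective hρ).toEquiv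
  have : Fintype ρ.range := Fintype.ofFinite _
  have h1 : Module.finrank (fixedField ρ.range) F = Nat.card G := by
    rw [Nat.card_congr (ρ.ofInjective hρ).toEquiv, Nat.card_eq_fintype_card]
    exact FixedPoints.finrank_eq_card ρ.range F
  have h2 : k⟮f⟯ ≤ fixedField ρ.range := by
    rw [adjoin_simple_le_iff]
    rintro ⟨_, g, rfl⟩
    exact hf g
  rw [← h1]
  exact finrank_dvd_of_le_left h2

theorem isCurveField_of_generators {x : F} (hx : Transcendental k x) [FiniteDimensional k⟮x⟯ F]
    {T : Finset F} (hT : adjoin k (T : Set F) = ⊤) : IsCurveField k F := by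
  refine ⟨⟨T, hT⟩, ⟨{x}, by simp, ?_⟩, x, hx⟩
  rw [Finset.coe_singleton]
  infer_instance

theorem transcendental_of_finrank_adjoin {x f : F} (hx : Transcendental k x)
    [FiniteDimensional k⟮f⟯ F] : Transcendental k f := by
  intro hf
  have h1 : FiniteDimensional k k⟮f⟯ := adjoin.finiteDimensional hf.isIntegral
  have h2 : FiniteDimensional k F := FiniteDimensional.trans k k⟮f⟯ F
  exact hx (Algebra.IsAlgebraic.isAlgebraic x)

end GroupAction
/-- Let `G` be a finite group.  Assume that `|G|` does not divide `n` and that `G`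
does not act nontrivially on any algebraic curve of genus at most `(n - 1)²`.  Then
no faithful irreducible `G`-curve `C` over the perfect field `k` admits a rational
function of degree `n`. -/
theorem no_degree_n_function_on_faithful_G_curve (k : Type) [Field k] [PerfectField k]
    (G : Type) [Group G] [Finite G] (n : ℕ) (hdvd : ¬ (Nat.card G ∣ n))
    (hcurves : ∀ (F' : Type) [Field F'] [Algebra k F'], IsCurveField k F' →
      genus k F' ≤ (n - 1) ^ 2 → ∀ ρ : G →* (F' ≃ₐ[k] F'), ρ = 1)
    (F : Type) [Field F] [Algebra k F] (hF : IsCurveField k F)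
    (ρ : G →* (F ≃ₐ[k] F)) (hρ : Function.Injective ρ) :
    ¬ ∃ f : F, RatFnDegree k F f n := by

  classical
  rintro ⟨f, hfin, rfl⟩
  obtain ⟨-, -, x, hx⟩ := hF
  have hf : Transcendental k f := transcendental_of_finrank_adjoin hx
  have hfinρ : ∀ g, FiniteDimensional k⟮ρ g f⟯ F := fun g => by
    refine FiniteDimensional.of_finrank_pos ?_
    rw [finrank_adjoin_apply]
    exact Module.finrank_pos
  have : Fintype G := Fintype.ofFinite G
  let E : IntermediateField k F := adjoin k (Set.range fun g => ρ g f)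
  have hmem : ∀ g, ρ g f ∈ E := fun g => subset_adjoin k _ ⟨g, rfl⟩
  have hE : ∀ g, ∀ y ∈ E, ρ g y ∈ E := by
    intro g y hy
    have h1 : E ≤ E.comap (ρ g).toAlgHom := by
      refine adjoin_le_iff.2 ?_
      rintro _ ⟨h, rfl⟩
      change ρ g (ρ h f) ∈ E
      rw [← AlgEquiv.mul_apply, ← map_mul]
      exact hmem _
    exact h1 hy
  let ρE := restrictAction ρ E hE
  let fE : E := ⟨f, by simpa using hmem 1⟩
  let T : Finset E := Finset.univ.image fun g => ρE g fE
  have htop : adjoin k (T : Set E) = ⊤ := by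
    apply lift_injective E
    rw [lift_adjoin, lift_top]
    congr 1
    simp only [T, Finset.coe_image, Finset.coe_univ, Set.image_univ, ← Set.range_comp]
    rfl
  have hfE : Transcendental k fE := fun h => hf (h.algebraMap (A := F))
  obtain ⟨hfinE, hle⟩ := finrank_adjoin_subtype_le (f := fE)
  have hgenus : genus k E ≤ (Module.finrank k⟮f⟯ F - 1) ^ 2 := by
    refine (genus_le hfE T (fun y hy => ?_) htop).trans
      (Nat.pow_le_pow_left (Nat.sub_le_sub_right hle 1) 2)
    obtain ⟨g, -, rfl⟩ := Finset.mem_image.1 hy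
    refine ⟨?_, ?_, (finrank_adjoin_apply (ρE g) fE).le⟩
    · rw [Ne, map_eq_zero_iff _ (ρE g).injective]
      rintro h0
      exact hfE (h0 ▸ isAlgebraic_zero)
    · refine FiniteDimensional.of_finrank_pos ?_
      rw [finrank_adjoin_apply]
      exact Module.finrank_pos
  have hρE := hcurves E (isCurveField_of_generators hfE htop) hgenus ρE
  refine hdvd (card_dvd_finrank_of_fixed ρ hρ fun g => ?_)
  exact congrArg Subtype.val (DFunLike.congr_fun (DFunLike.congr_fun hρE g) fE)
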